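/- arXiv:1310.5455 — 2 statements merged into one kernel-verified Lean document; each statement's English description precedes it below -/
import Mathlib

section
/- Let f be a nonzero idempotent of the split Okubo algebra (O,*) over a field F, and define τ : O → O by τ(x) = f*(f*x). Then τ is bijective, τ(x*y) = τ(x)*τ(y) for all x, y (so τ is an automorphism of (O,*)), τ also preserves the product x·y := (f*x)*(y*f) (τ(x·y) = τ(x)·τ(y)), τ∘τ∘τ = id with τ ≠ id (τ has order 3), and the fixed subspace {x ∈ O | τ(x) = x} equals the centralizer {x ∈ O | x*f = f*x} of f. -/
open scoped BigOperators

/-- The grading group `ℤ₃ × ℤ₃`. -/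
abbrev OkG : Type := ZMod 3 × ZMod 3

/-- The index set of the standard basis of the split Okubo algebra:
the nonzero elements of `ℤ₃ × ℤ₃`. -/
abbrev OkI : Type := {g : OkG // g ≠ 0}

variable (R : Type) [CommRing R]

/-- The structure constants `c(g,h) = 1 - ((g₁h₂ - g₂h₁).val : ℤ)` of the split Okubo algebra. -/
def okc (g h : OkG) : R :=
  ((1 - (((g.1 * h.2 - g.2 * h.1 : ZMod 3)).val : ℤ) : ℤ) : R)

/-- Underlying function of the split Okubo multiplication. -/
def okMulFun (x y : OkI → R) : OkI → R := fun k =>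
  ∑ g : OkI, ∑ h : OkI,
    (if (g : OkG) + (h : OkG) = (k : OkG) then okc R (g : OkG) (h : OkG) else 0) * (x g * y h)

/-- The split Okubo multiplication, as a bilinear map: the unique `R`-bilinear map with
`e_g * e_h = 0` if `g + h = 0` and `e_g * e_h = c(g,h) • e_(g+h)` otherwise. -/
def okMul : (OkI → R) →ₗ[R] (OkI → R) →ₗ[R] (OkI → R) :=
  LinearMap.mk₂ R (okMulFun R)
    (by intro m₁ m₂ n; funext k; simp [okMulFun, add_mul, mul_add, Finset.sum_add_distrib])
    (by intro c m n; funext k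
        simp only [okMulFun, Pi.smul_apply, smul_eq_mul, Finset.mul_sum]
        exact Finset.sum_congr rfl fun g _ => Finset.sum_congr rfl fun h _ => by ring)
    (by intro m n₁ n₂; funext k; simp [okMulFun, add_mul, mul_add, Finset.sum_add_distrib])
    (by intro c m n; funext k
        simp only [okMulFun, Pi.smul_apply, smul_eq_mul, Finset.mul_sum]
        exact Finset.sum_congr rfl fun g _ => Finset.sum_congr rfl fun h _ => by ring)

/-- The norm (quadratic form) of the split Okubo algebra: the unique quadratic form
with `n(e_g) = 0` and polar form `b(e_g, e_h) = 1` if `g + h = 0`, and `0` otherwise. -/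
def okN (x : OkI → R) : R :=
  x ⟨(1, 0), by decide⟩ * x ⟨(2, 0), by decide⟩ +
  x ⟨(0, 1), by decide⟩ * x ⟨(0, 2), by decide⟩ +
  x ⟨(1, 1), by decide⟩ * x ⟨(2, 2), by decide⟩ +
  x ⟨(1, 2), by decide⟩ * x ⟨(2, 1), by decide⟩

/-- The polar form of the norm `okN`. -/
def okB (x y : OkI → R) : R := okN R (x + y) - okN R x - okN R y

/-- The basis element `e_g` of the split Okubo algebra. -/
def okE (g : OkI) : OkI → R := Pi.single g 1

/-- The sum `e = ∑_{g ∈ I} e_g` of all eight basis elements. -/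
def oke : OkI → R := ∑ g : OkI, okE R g

theorem okI_univ : (Finset.univ : Finset OkI) =
    {⟨(0, 1), by decide⟩, ⟨(0, 2), by decide⟩, ⟨(1, 0), by decide⟩, ⟨(1, 1), by decide⟩,
      ⟨(1, 2), by decide⟩, ⟨(2, 0), by decide⟩, ⟨(2, 1), by decide⟩, ⟨(2, 2), by decide⟩} := by
  decide

theorem okI_sum {M : Type*} [AddCommMonoid M] (φ : OkI → M) :
    ∑ g, φ g = φ ⟨(0, 1), by decide⟩ + (φ ⟨(0, 2), by decide⟩ + (φ ⟨(1, 0), by decide⟩ +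
      (φ ⟨(1, 1), by decide⟩ + (φ ⟨(1, 2), by decide⟩ + (φ ⟨(2, 0), by decide⟩ +
      (φ ⟨(2, 1), by decide⟩ + φ ⟨(2, 2), by decide⟩)))))) := by
  rw [okI_univ]
  repeat rw [Finset.sum_insert (by decide)]
  rw [Finset.sum_singleton]

theorem okc_eq_ite (g h : OkG) :
    okc R g h = if g.1 * h.2 - g.2 * h.1 = 0 then 1
      else if g.1 * h.2 - g.2 * h.1 = 1 then 0 else -1 := by
  unfold okc
  generalize g.1 * h.2 - g.2 * h.1 = d
  have h : ((1 - (d.val : ℤ) : ℤ)) = if d = 0 then 1 else if d = 1 then 0 else -1 := by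
    revert d; decide
  rw [h]
  split_ifs <;> simp

theorem okMul_apply (x y : OkI → R) (k : OkI) :
    okMul R x y k = ∑ g : OkI, if h : (k : OkG) - g ≠ 0 then
      okc R g k * (x g * y ⟨(k : OkG) - g, h⟩) else 0 := by
  change okMulFun R x y k = _
  unfold okMulFun
  refine Finset.sum_congr rfl fun g _ => ?_
  split_ifs with hk
  · rw [Finset.sum_eq_single ⟨(k : OkG) - g, hk⟩]
    · have h : (g : OkG).1 * ((k : OkG) - g).2 - (g : OkG).2 * ((k : OkG) - g).1 =
          (g : OkG).1 * (k : OkG).2 - (g : OkG).2 * (k : OkG).1 := by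
        simp only [Prod.fst_sub, Prod.snd_sub]; ring
      simp only [add_sub_cancel, if_true, okc, h]
    · intro h _ hne
      rw [if_neg, zero_mul]
      rintro e
      exact hne (Subtype.ext (eq_sub_of_add_eq' e))
    · simp
  · refine Finset.sum_eq_zero fun h _ => ?_
    rw [if_neg, zero_mul]
    rintro e
    exact hk (by rw [← e, add_sub_cancel_left]; exact h.2)

/-- The coordinates of the product, in closed form. -/
theorem okMul_coord (x y : OkI → R) :
    okMul R x y ⟨(0, 1), by decide⟩ =
        x ⟨(0, 2), by decide⟩ * y ⟨(0, 2), by decide⟩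
        - x ⟨(2, 0), by decide⟩ * y ⟨(1, 1), by decide⟩
        - x ⟨(2, 1), by decide⟩ * y ⟨(1, 0), by decide⟩
        - x ⟨(2, 2), by decide⟩ * y ⟨(1, 2), by decide⟩ ∧
    okMul R x y ⟨(0, 2), by decide⟩ =
        x ⟨(0, 1), by decide⟩ * y ⟨(0, 1), by decide⟩
        - x ⟨(1, 0), by decide⟩ * y ⟨(2, 2), by decide⟩
        - x ⟨(1, 1), by decide⟩ * y ⟨(2, 1), by decide⟩
        - x ⟨(1, 2), by decide⟩ * y ⟨(2, 0), by decide⟩ ∧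
    okMul R x y ⟨(1, 0), by decide⟩ =
        x ⟨(2, 0), by decide⟩ * y ⟨(2, 0), by decide⟩
        - x ⟨(0, 1), by decide⟩ * y ⟨(1, 2), by decide⟩
        - x ⟨(1, 1), by decide⟩ * y ⟨(0, 2), by decide⟩
        - x ⟨(2, 1), by decide⟩ * y ⟨(2, 2), by decide⟩ ∧
    okMul R x y ⟨(1, 1), by decide⟩ =
        x ⟨(2, 2), by decide⟩ * y ⟨(2, 2), by decide⟩
        - x ⟨(0, 1), by decide⟩ * y ⟨(1, 0), by decide⟩
        - x ⟨(1, 2), by decide⟩ * y ⟨(0, 2), by decide⟩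
        - x ⟨(2, 0), by decide⟩ * y ⟨(2, 1), by decide⟩ ∧
    okMul R x y ⟨(1, 2), by decide⟩ =
        x ⟨(2, 1), by decide⟩ * y ⟨(2, 1), by decide⟩
        - x ⟨(0, 1), by decide⟩ * y ⟨(1, 1), by decide⟩
        - x ⟨(1, 0), by decide⟩ * y ⟨(0, 2), by decide⟩
        - x ⟨(2, 2), by decide⟩ * y ⟨(2, 0), by decide⟩ ∧
    okMul R x y ⟨(2, 0), by decide⟩ =
        x ⟨(1, 0), by decide⟩ * y ⟨(1, 0), by decide⟩
        - x ⟨(0, 2), by decide⟩ * y ⟨(2, 1), by decide⟩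
        - x ⟨(1, 2), by decide⟩ * y ⟨(1, 1), by decide⟩
        - x ⟨(2, 2), by decide⟩ * y ⟨(0, 1), by decide⟩ ∧
    okMul R x y ⟨(2, 1), by decide⟩ =
        x ⟨(1, 2), by decide⟩ * y ⟨(1, 2), by decide⟩
        - x ⟨(0, 2), by decide⟩ * y ⟨(2, 2), by decide⟩
        - x ⟨(1, 1), by decide⟩ * y ⟨(1, 0), by decide⟩
        - x ⟨(2, 0), by decide⟩ * y ⟨(0, 1), by decide⟩ ∧
    okMul R x y ⟨(2, 2), by decide⟩ =
        x ⟨(1, 1), by decide⟩ * y ⟨(1, 1), by decide⟩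
        - x ⟨(0, 2), by decide⟩ * y ⟨(2, 0), by decide⟩
        - x ⟨(1, 0), by decide⟩ * y ⟨(1, 2), by decide⟩
        - x ⟨(2, 1), by decide⟩ * y ⟨(0, 1), by decide⟩ := by
  have h₁ : (-1 : ZMod 3) = 2 := by decide
  have h₂ : (-2 : ZMod 3) = 1 := by decide
  have h₃ : (1 - 2 : ZMod 3) = 2 := by decide
  have h₄ : (2 - 1 : ZMod 3) = 1 := by decide
  refine ⟨?_, ?_, ?_, ?_, ?_, ?_, ?_, ?_⟩ <;>
  · rw [okMul_apply, okI_sum]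
    simp +decide [okc_eq_ite, h₁, h₂, h₃, h₄]
    ring


theorem okI_forall {p : OkI → Prop} (h₁ : p ⟨(0, 1), by decide⟩) (h₂ : p ⟨(0, 2), by decide⟩)
    (h₃ : p ⟨(1, 0), by decide⟩) (h₄ : p ⟨(1, 1), by decide⟩) (h₅ : p ⟨(1, 2), by decide⟩)
    (h₆ : p ⟨(2, 0), by decide⟩) (h₇ : p ⟨(2, 1), by decide⟩) (h₈ : p ⟨(2, 2), by decide⟩)
    (g : OkI) : p g := by
  have hg := Finset.mem_univ g
  rw [okI_univ] at hg
  simp only [Finset.mem_insert, Finset.mem_singleton] at hg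
  rcases hg with rfl | rfl | rfl | rfl | rfl | rfl | rfl | rfl <;> assumption

theorem okMul_okMul_self_left (x y : OkI → R) :
    okMul R (okMul R x y) x = okN R x • y := by
  funext k
  revert k
  apply okI_forall <;>
  · simp only [okMul_coord, okN, Pi.smul_apply, smul_eq_mul]
    ring

theorem okMul_self_okMul (x y : OkI → R) :
    okMul R x (okMul R y x) = okN R x • y := by
  funext k
  revert k
  apply okI_forall <;>
  · simp only [okMul_coord, okN, Pi.smul_apply, smul_eq_mul]
    ring

theorem okB_okMul (x y z : OkI → R) : okB R (okMul R x y) z = okB R x (okMul R y z) := by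
  simp only [okB, okN, okMul_coord, Pi.add_apply]
  ring

theorem okMul_okMul_add (x y z : OkI → R) :
    okMul R (okMul R x y) z + okMul R (okMul R z y) x = okB R x z • y := by
  have h := okMul_okMul_self_left R (x + z) y
  simp only [map_add, LinearMap.add_apply, okMul_okMul_self_left] at h
  rw [okB, sub_smul, sub_smul, ← h]
  abel

theorem okMul_okMul_add' (x y z : OkI → R) :
    okMul R x (okMul R y z) + okMul R z (okMul R y x) = okB R x z • y := by
  have h := okMul_self_okMul R (x + z) y
  simp only [map_add, LinearMap.add_apply, okMul_self_okMul] at h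
  rw [okB, sub_smul, sub_smul, ← h]
  abel

theorem okB_comm (x y : OkI → R) : okB R x y = okB R y x := by
  rw [okB, okB, add_comm x y]
  ring

theorem okMul_single_right (x : OkI → R) (k g : OkI) (h : (k : OkG) + g ≠ 0) :
    okMul R x (okE R g) ⟨k + g, h⟩ = okc R k g * x k := by
  change okMulFun R x (okE R g) _ = _
  unfold okMulFun okE
  rw [Finset.sum_eq_single k, Finset.sum_eq_single g]
  · simp
  · intro b _ hb
    simp [hb]
  · simp
  · intro a _ ha
    refine Finset.sum_eq_zero fun b _ => ?_
    by_cases hb : b = g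
    · subst hb
      simp [Subtype.coe_inj, ha]
    · simp [hb]
  · simp

theorem okMul_single_left (x : OkI → R) (k g : OkI) (h : (k : OkG) + g ≠ 0) :
    okMul R (okE R g) x ⟨k + g, h⟩ = okc R g k * x k := by
  change okMulFun R (okE R g) x _ = _
  unfold okMulFun okE
  rw [Finset.sum_eq_single g, Finset.sum_eq_single k]
  · simp [add_comm]
  · intro b _ hb
    simp [add_comm (k : OkG), Subtype.coe_inj, hb]
  · simp
  · intro a _ ha
    simp [ha]
  · simp

variable {R} in
/-- An element commuting with every basis element is zero. -/
theorem eq_zero_of_forall_okMul_comm {f : OkI → R}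
    (h : ∀ g, okMul R (okE R g) f = okMul R f (okE R g)) : f = 0 := by
  funext k
  obtain ⟨g, hkg, h₁, h₂⟩ : ∃ g : OkI, (k : OkG) + g ≠ 0 ∧
      (k : OkG).1 * (g : OkG).2 - (k : OkG).2 * (g : OkG).1 = 1 ∧
      (g : OkG).1 * (k : OkG).2 - (g : OkG).2 * (k : OkG).1 = 2 := by
    revert k; decide
  have hk := congrFun (h g) ⟨k + g, hkg⟩
  rw [okMul_single_left, okMul_single_right, okc_eq_ite, okc_eq_ite, h₁, h₂] at hk
  simpa +decide using hk

section Idempotent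

variable {F : Type} [Field F] {f : OkI → F}

theorem okN_eq_one_of_idempotent (hf : okMul F f f = f) (hf0 : f ≠ 0) : okN F f = 1 := by
  have h := okMul_okMul_self_left F f f
  rw [hf, hf] at h
  by_contra hne
  refine hf0 ((smul_eq_zero.mp ?_).resolve_left (sub_ne_zero.mpr hne))
  rw [sub_smul, ← h, one_smul, sub_self]

theorem okMul_idempotent_okMul (hf : okMul F f f = f) (x : OkI → F) :
    okMul F f (okMul F f x) = okB F f x • f - okMul F x f := by
  rw [eq_sub_iff_add_eq, ← okMul_okMul_add' F f f x, hf]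

theorem okMul_okMul_idempotent (hf : okMul F f f = f) (x : OkI → F) :
    okMul F (okMul F x f) f = okB F f x • f - okMul F f x := by
  rw [eq_sub_iff_add_eq, okB_comm, ← okMul_okMul_add F x f f, hf]

theorem okB_idempotent_okMul (hf : okMul F f f = f) (x : OkI → F) :
    okB F f (okMul F x f) = okB F f x := by
  rw [okB_comm, okB_okMul, hf, okB_comm]

/-- The cube of left multiplication by an idempotent is the canonical involution of the
associated Hurwitz product. -/
theorem okMul_idempotent_cube (hf : okMul F f f = f) (hn : okN F f = 1) (x : OkI → F) :
    okMul F f (okMul F f (okMul F f x)) = okB F f x • f - x := by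
  rw [okMul_idempotent_okMul hf x, map_sub, map_smul, hf, okMul_self_okMul, hn, one_smul]

theorem okMul_idempotent_map_mul (hf : okMul F f f = f) (hn : okN F f = 1) (x y : OkI → F) :
    okMul F f (okMul F f (okMul F x y)) =
      okMul F (okMul F f (okMul F f x)) (okMul F f (okMul F f y)) := by
  have h₁ : okMul F f (okMul F x y) = okB F f y • x - okMul F y (okMul F x f) := by
    rw [eq_sub_iff_add_eq, okMul_okMul_add']
  have h₂ : okMul F f (okMul F y (okMul F x f)) =
      okB F f x • y - okMul F (okMul F x f) (okMul F y f) := by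
    rw [eq_sub_iff_add_eq, okMul_okMul_add', okB_idempotent_okMul hf]
  rw [h₁, map_sub, map_smul, h₂, okMul_idempotent_okMul hf x, okMul_idempotent_okMul hf y]
  simp only [map_sub, map_smul, LinearMap.sub_apply, LinearMap.smul_apply, hf,
    okMul_okMul_idempotent hf, okMul_self_okMul, hn, one_smul]
  module

end Idempotent

/-- Let `f` be a nonzero idempotent of the split Okubo algebra `(O,*)`
over a field `F` and `τ(x) = f*(f*x)`. Then `τ` is bijective, it is an automorphism of
`(O,*)` and of the unital composition product `x · y = (f*x)*(y*f)`, it has order `3`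
(`τ³ = id`, `τ ≠ id`), and its fixed subspace is the centralizer of `f`. -/
theorem okubo_idempotent_triality_automorphism (F : Type) [Field F]
    (f : OkI → F) (hf : okMul F f f = f) (hf0 : f ≠ 0)
    (τ : (OkI → F) → (OkI → F)) (hτ : ∀ x, τ x = okMul F f (okMul F f x))
    (cdot : (OkI → F) → (OkI → F) → (OkI → F))
    (hcdot : ∀ x y, cdot x y = okMul F (okMul F f x) (okMul F y f)) :
    Function.Bijective τ ∧
    (∀ x y, τ (okMul F x y) = okMul F (τ x) (τ y)) ∧
    (∀ x y, τ (cdot x y) = cdot (τ x) (τ y)) ∧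
    (∀ x, τ (τ (τ x)) = x) ∧
    τ ≠ id ∧
    {x : OkI → F | τ x = x} = {x : OkI → F | okMul F x f = okMul F f x} := by
  have hn := okN_eq_one_of_idempotent hf hf0
  have hτf : τ f = f := by rw [hτ, hf, hf]
  have hmul (x y) : τ (okMul F x y) = okMul F (τ x) (τ y) := by
    simp only [hτ]
    exact okMul_idempotent_map_mul hf hn x y
  have hcube (x) : τ (τ (τ x)) = x := by
    simp only [hτ]
    rw [okMul_idempotent_cube hf hn x, map_sub, map_sub, map_sub, okMul_idempotent_cube hf hn x]
    simp [hf]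
  have hinv (x) : okMul F f (okMul F x f) = x := by
    rw [okMul_self_okMul, hn, one_smul]
  have hfix (x) : τ x = x ↔ okMul F x f = okMul F f x := by
    rw [hτ]
    constructor
    · intro h
      calc okMul F x f = okMul F (okMul F f (okMul F f x)) f := by rw [h]
        _ = okMul F f x := by rw [okMul_okMul_self_left, hn, one_smul]
    · intro h
      rw [← h, hinv]
  refine ⟨Function.bijective_iff_has_inverse.mpr ⟨τ ∘ τ, hcube, hcube⟩, hmul, fun x y => ?_,
    hcube, fun hid => ?_, Set.ext hfix⟩
  · rw [hcdot, hcdot, hmul, hmul, hmul, hτf]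
  · exact hf0 (eq_zero_of_forall_okMul_comm fun g => (hfix _).mp (congrFun hid _))
end

section
/- Let F be algebraically closed of characteristic 3 and let f, g be nonzero idempotents of the split Okubo algebra (O, *, n). Write C(f) = {x ∈ O | x*f = f*x}, rad(f) = {v ∈ C(f) | n(v) = 0 and b(v,w) = 0 for all w ∈ C(f)}, and rank(f) = dim C(f) − dim rad(f), and similarly for g. If dim C(f) = dim C(g) = 4 and rank(f) = rank(g) = 2 (both quadratic), or if dim C(f) = dim C(g) = 4 and rank(f) = rank(g) = 1 (both singular), then there exists an F-linear bijection φ of O with φ(x*y) = φ(x)*φ(y) for all x, y and φ(f) = g. That is, the quadratic idempotents form a single orbit under the automorphism group, and so do the singular idempotents. -/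
open scoped BigOperators

variable (R : Type) [CommRing R]

/-- The centralizer `{x | x * f = f * x}` of `f` in the split Okubo algebra. -/
def okCent (f : OkI → R) : Submodule R (OkI → R) where
  carrier := {x | okMul R x f = okMul R f x}
  add_mem' := by
    intro a b ha hb
    simp only [Set.mem_setOf_eq] at ha hb ⊢
    simp [map_add, LinearMap.add_apply, ha, hb]
  zero_mem' := by simp
  smul_mem' := by
    intro c a ha
    simp only [Set.mem_setOf_eq] at ha ⊢
    simp [map_smul, LinearMap.smul_apply, ha]

lemma okN_add (x y : OkI → R) : okN R (x + y) = okN R x + okN R y + okB R x y := by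
  simp [okB]

lemma okB_add_left (x y z : OkI → R) : okB R (x + y) z = okB R x z + okB R y z := by
  simp [okB, okN]; ring

lemma okN_smul (c : R) (x : OkI → R) : okN R (c • x) = c * c * okN R x := by
  simp [okN, smul_eq_mul]; ring

lemma okB_smul_left (c : R) (x y : OkI → R) : okB R (c • x) y = c * okB R x y := by
  simp [okB, okN, smul_eq_mul]; ring

/-- The radical of the restriction of the norm `okN` (with polar form `okB`) to the
centralizer of `f`. -/
def okRad (f : OkI → R) : Submodule R (OkI → R) where
  carrier := {v | v ∈ okCent R f ∧ okN R v = 0 ∧ ∀ w ∈ okCent R f, okB R v w = 0}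
  add_mem' := by
    intro a b ha hb
    refine ⟨(okCent R f).add_mem ha.1 hb.1, ?_, ?_⟩
    · rw [okN_add, ha.2.1, hb.2.1, ha.2.2 b hb.1]; ring
    · intro w hw; rw [okB_add_left, ha.2.2 w hw, hb.2.2 w hw]; ring
  zero_mem' := by
    refine ⟨(okCent R f).zero_mem, by simp [okN], ?_⟩
    intro w hw; simp [okB, okN]
  smul_mem' := by
    intro c a ha
    refine ⟨(okCent R f).smul_mem c ha.1, ?_, ?_⟩
    · rw [okN_smul, ha.2.1]; ring
    · intro w hw; rw [okB_smul_left, ha.2.2 w hw]; ring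

namespace OkModel

section MulFormula

variable {F : Type} [CommRing F]

theorem sum_OkI {M : Type*} [AddCommMonoid M] (f : OkI → M) :
    ∑ g, f g = f ⟨(1, 0), by decide⟩ + f ⟨(2, 0), by decide⟩ + f ⟨(0, 1), by decide⟩ +
      f ⟨(0, 2), by decide⟩ + f ⟨(1, 1), by decide⟩ + f ⟨(2, 2), by decide⟩ +
      f ⟨(1, 2), by decide⟩ + f ⟨(2, 1), by decide⟩ := by
  have h : (Finset.univ : Finset OkI) = {⟨(1, 0), by decide⟩, ⟨(2, 0), by decide⟩,
    ⟨(0, 1), by decide⟩, ⟨(0, 2), by decide⟩, ⟨(1, 1), by decide⟩, ⟨(2, 2), by decide⟩,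
    ⟨(1, 2), by decide⟩, ⟨(2, 1), by decide⟩} := by decide
  rw [h]
  repeat rw [Finset.sum_insert (by decide)]
  simp [add_assoc]

theorem okc_eq (g h : OkG) : okc F g h =
    if g.1 * h.2 - g.2 * h.1 = 0 then 1 else if g.1 * h.2 - g.2 * h.1 = 1 then 0 else -1 := by
  unfold okc
  generalize g.1 * h.2 - g.2 * h.1 = d
  have hd : ∀ d : ZMod 3, 1 - (d.val : ℤ) = if d = 0 then 1 else if d = 1 then 0 else -1 := by
    decide
  rw [hd]
  split_ifs <;> simp

theorem okMulFun_one_zero (x y : OkI → F) :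
    okMulFun F x y ⟨(1, 0), by decide⟩ =
      x ⟨(2, 0), by decide⟩ * y ⟨(2, 0), by decide⟩
        - x ⟨(0, 1), by decide⟩ * y ⟨(1, 2), by decide⟩
        - x ⟨(1, 1), by decide⟩ * y ⟨(0, 2), by decide⟩
        - x ⟨(2, 1), by decide⟩ * y ⟨(2, 2), by decide⟩ := by
  simp (decide := true) only [okMulFun, sum_OkI, okc_eq, if_true, if_false]
  ring

theorem okMulFun_two_zero (x y : OkI → F) :
    okMulFun F x y ⟨(2, 0), by decide⟩ =
      x ⟨(1, 0), by decide⟩ * y ⟨(1, 0), by decide⟩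
        - x ⟨(0, 2), by decide⟩ * y ⟨(2, 1), by decide⟩
        - x ⟨(2, 2), by decide⟩ * y ⟨(0, 1), by decide⟩
        - x ⟨(1, 2), by decide⟩ * y ⟨(1, 1), by decide⟩ := by
  simp (decide := true) only [okMulFun, sum_OkI, okc_eq, if_true, if_false]
  ring

theorem okMulFun_zero_one (x y : OkI → F) :
    okMulFun F x y ⟨(0, 1), by decide⟩ =
      -x ⟨(2, 0), by decide⟩ * y ⟨(1, 1), by decide⟩
        + x ⟨(0, 2), by decide⟩ * y ⟨(0, 2), by decide⟩
        - x ⟨(2, 2), by decide⟩ * y ⟨(1, 2), by decide⟩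
        - x ⟨(2, 1), by decide⟩ * y ⟨(1, 0), by decide⟩ := by
  simp (decide := true) only [okMulFun, sum_OkI, okc_eq, if_true, if_false]
  ring

theorem okMulFun_zero_two (x y : OkI → F) :
    okMulFun F x y ⟨(0, 2), by decide⟩ =
      -x ⟨(1, 0), by decide⟩ * y ⟨(2, 2), by decide⟩
        + x ⟨(0, 1), by decide⟩ * y ⟨(0, 1), by decide⟩
        - x ⟨(1, 1), by decide⟩ * y ⟨(2, 1), by decide⟩
        - x ⟨(1, 2), by decide⟩ * y ⟨(2, 0), by decide⟩ := by
  simp (decide := true) only [okMulFun, sum_OkI, okc_eq, if_true, if_false]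
  ring

theorem okMulFun_one_one (x y : OkI → F) :
    okMulFun F x y ⟨(1, 1), by decide⟩ =
      -x ⟨(2, 0), by decide⟩ * y ⟨(2, 1), by decide⟩
        - x ⟨(0, 1), by decide⟩ * y ⟨(1, 0), by decide⟩
        + x ⟨(2, 2), by decide⟩ * y ⟨(2, 2), by decide⟩
        - x ⟨(1, 2), by decide⟩ * y ⟨(0, 2), by decide⟩ := by
  simp (decide := true) only [okMulFun, sum_OkI, okc_eq, if_true, if_false]
  ring

theorem okMulFun_two_two (x y : OkI → F) :
    okMulFun F x y ⟨(2, 2), by decide⟩ =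
      -x ⟨(1, 0), by decide⟩ * y ⟨(1, 2), by decide⟩
        - x ⟨(0, 2), by decide⟩ * y ⟨(2, 0), by decide⟩
        + x ⟨(1, 1), by decide⟩ * y ⟨(1, 1), by decide⟩
        - x ⟨(2, 1), by decide⟩ * y ⟨(0, 1), by decide⟩ := by
  simp (decide := true) only [okMulFun, sum_OkI, okc_eq, if_true, if_false]
  ring

theorem okMulFun_one_two (x y : OkI → F) :
    okMulFun F x y ⟨(1, 2), by decide⟩ =
      -x ⟨(1, 0), by decide⟩ * y ⟨(0, 2), by decide⟩
        - x ⟨(0, 1), by decide⟩ * y ⟨(1, 1), by decide⟩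
        - x ⟨(2, 2), by decide⟩ * y ⟨(2, 0), by decide⟩
        + x ⟨(2, 1), by decide⟩ * y ⟨(2, 1), by decide⟩ := by
  simp (decide := true) only [okMulFun, sum_OkI, okc_eq, if_true, if_false]
  ring

theorem okMulFun_two_one (x y : OkI → F) :
    okMulFun F x y ⟨(2, 1), by decide⟩ =
      -x ⟨(2, 0), by decide⟩ * y ⟨(0, 1), by decide⟩
        - x ⟨(0, 2), by decide⟩ * y ⟨(2, 2), by decide⟩
        - x ⟨(1, 1), by decide⟩ * y ⟨(1, 0), by decide⟩
        + x ⟨(1, 2), by decide⟩ * y ⟨(1, 2), by decide⟩ := by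
  simp (decide := true) only [okMulFun, sum_OkI, okc_eq, if_true, if_false]
  ring

end MulFormula

variable {F : Type} [Field F]

/-- The split Okubo product in characteristic `3`, in coordinates. Writing
`A = F[u, v] / (u³, v³)`, with trace form `t` the sum of the constant and `u²v²` coefficients and
Poisson bracket `{u, v} = 1 - u²v²`, this is the product `fg - {f, g} - t(fg)` on the kernel of
`t`, with respect to the basis `u, v, u², uv, v², u²v, uv², u²v² - 1`. -/
def mul (x y : Fin 8 → F) : Fin 8 → F :=
  ![-x 0 * y 7 - x 7 * y 0 - x 0 * y 3 + x 2 * y 1 - x 1 * y 2 + x 3 * y 0,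
    -x 1 * y 7 - x 7 * y 1 + x 0 * y 4 - x 3 * y 1 + x 1 * y 3 - x 4 * y 0,
    x 0 * y 0 - x 2 * y 7 - x 7 * y 2 - x 0 * y 5 + x 2 * y 3 - x 3 * y 2 + x 5 * y 0,
    x 0 * y 1 + x 1 * y 0 - x 3 * y 7 - x 7 * y 3 + x 0 * y 6 - x 2 * y 4 + x 5 * y 1
      - x 1 * y 5 + x 4 * y 2 - x 6 * y 0,
    x 1 * y 1 - x 4 * y 7 - x 7 * y 4 + x 3 * y 4 - x 6 * y 1 + x 1 * y 6 - x 4 * y 3,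
    x 0 * y 3 + x 1 * y 2 + x 2 * y 1 + x 3 * y 0 - x 5 * y 7 - x 7 * y 5 + x 0 * y 7
      - x 2 * y 6 + x 3 * y 5 - x 5 * y 3 + x 6 * y 2 - x 7 * y 0,
    x 0 * y 4 + x 1 * y 3 + x 3 * y 1 + x 4 * y 0 - x 6 * y 7 - x 7 * y 6 - x 3 * y 6
      - x 5 * y 4 + x 6 * y 3 + x 7 * y 1 - x 1 * y 7 + x 4 * y 5,
    x 0 * y 6 + x 1 * y 5 + x 2 * y 4 + x 3 * y 3 + x 4 * y 2 + x 5 * y 1 + x 6 * y 0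
      + x 7 * y 7 + x 0 * y 1 - x 1 * y 0]

/-- The norm of the split Okubo algebra in the coordinates of `OkModel.mul`. -/
def norm (x : Fin 8 → F) : F :=
  x 7 * x 7 + x 0 * x 6 + x 1 * x 5 + x 2 * x 4 - x 3 * x 3

/-- The automorphism induced by `u ↦ u + a v + b v²`, `v ↦ v`. -/
def shear (a b : F) : (Fin 8 → F) →ₗ[F] (Fin 8 → F) where
  toFun x := ![x 0, a * x 0 + x 1, x 2, x 3 - a * x 2, b * x 0 + a * a * x 2 + a * x 3 + x 4,
    x 5, x 6 - b * x 2 - a * x 5, x 7]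
  map_add' x y := by ext i; fin_cases i <;> simp <;> ring
  map_smul' r x := by ext i; fin_cases i <;> simp <;> ring

/-- The automorphism induced by `v ↦ v / (1 - c v)`, `u ↦ u (1 - c v)²`. -/
def moebius (c : F) : (Fin 8 → F) →ₗ[F] (Fin 8 → F) where
  toFun x := ![x 0, x 1, x 2, c * x 0 + x 3, c * x 1 + x 4, x 5 - c * x 2,
    c * c * x 0 - c * x 3 + x 6, x 7]
  map_add' x y := by ext i; fin_cases i <;> simp <;> ring
  map_smul' r x := by ext i; fin_cases i <;> simp <;> ring

/-- The automorphism induced by `u ↦ v`, `v ↦ -u`. -/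
def swap : (Fin 8 → F) →ₗ[F] (Fin 8 → F) where
  toFun x := ![-x 1, x 0, x 4, -x 3, x 2, x 6, -x 5, x 7]
  map_add' x y := by ext i; fin_cases i <;> simp <;> ring
  map_smul' r x := by ext i; fin_cases i <;> simp

theorem shear_mul [CharP F 3] (a b : F) (x y : Fin 8 → F) :
    shear a b (mul x y) = mul (shear a b x) (shear a b y) := by
  ext i
  fin_cases i <;> simp [shear, mul] <;> grind

theorem moebius_mul [CharP F 3] (c : F) (x y : Fin 8 → F) :
    moebius c (mul x y) = mul (moebius c x) (moebius c y) := by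
  ext i
  fin_cases i <;> simp [moebius, mul] <;> grind

theorem swap_mul (x y : Fin 8 → F) : swap (mul x y) = mul (swap x) (swap y) := by
  ext i
  fin_cases i <;> simp [swap, mul] <;> ring

theorem norm_shear [CharP F 3] (a b : F) (x : Fin 8 → F) : norm (shear a b x) = norm x := by
  simp [shear, norm]
  grind

theorem norm_moebius [CharP F 3] (c : F) (x : Fin 8 → F) : norm (moebius c x) = norm x := by
  simp [moebius, norm]
  grind

theorem norm_swap (x : Fin 8 → F) : norm (swap x) = norm x := by
  simp [swap, norm]
  ring

theorem shear_shear_neg [CharP F 3] (a b : F) (x : Fin 8 → F) : shear a b (shear (-a) (-b) x) = x := by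
  ext i
  fin_cases i <;> simp [shear] <;> grind

theorem moebius_moebius_neg [CharP F 3] (c : F) (x : Fin 8 → F) : moebius c (moebius (-c) x) = x := by
  ext i
  fin_cases i <;> simp [moebius]; grind

theorem swap_four (x : Fin 8 → F) : swap (swap (swap (swap x))) = x := by
  ext i
  fin_cases i <;> simp [swap]

theorem coords_of_idempotent [CharP F 3] {x : Fin 8 → F} (hx : mul x x = x) (hx0 : x ≠ 0) :
    x 0 = 0 ∧ x 1 = 0 ∧ x 7 = 1 ∧ x 3 * x 3 = x 2 * x 4 := by
  have h (i) := congrFun hx i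
  have h0 := h 0
  have h1 := h 1
  have h2 := h 2
  have h3 := h 3
  have h4 := h 4
  have h5 := h 5
  have h6 := h 6
  have h7 := h 7
  simp [mul] at h0 h1 h2 h3 h4 h5 h6 h7
  by_cases hx7 : x 7 = 1
  · have e0 : x 0 = 0 := by
      have : x 0 * x 0 = 0 := by grind
      simpa using this
    have e1 : x 1 = 0 := by
      have : x 1 * x 1 = 0 := by grind
      simpa using this
    exact ⟨e0, e1, hx7, by grind⟩
  · have key {t : F} (ht : t * x 7 = t) : t = 0 := by
      have : t * (x 7 - 1) = 0 := by linear_combination ht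
      exact (mul_eq_zero.mp this).resolve_right (sub_ne_zero.mpr hx7)
    have e0 : x 0 = 0 := key (by grind)
    have e1 : x 1 = 0 := key (by grind)
    have e2 : x 2 = 0 := key (by grind)
    have e3 : x 3 = 0 := key (by grind)
    have e4 : x 4 = 0 := key (by grind)
    have e5 : x 5 = 0 := key (by grind)
    have e6 : x 6 = 0 := key (by grind)
    have e7 : x 7 = 0 := key (by grind)
    refine absurd ?_ hx0
    ext i
    fin_cases i <;> assumption

/-- The coordinates of an element of the split Okubo algebra. -/
def coords : (OkI → F) →ₗ[F] (Fin 8 → F) where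
  toFun p := ![
    p ⟨(1, 0), by decide⟩ - p ⟨(2, 0), by decide⟩ + p ⟨(1, 1), by decide⟩
      - p ⟨(2, 2), by decide⟩ + p ⟨(1, 2), by decide⟩ - p ⟨(2, 1), by decide⟩,
    p ⟨(0, 1), by decide⟩ - p ⟨(0, 2), by decide⟩ + p ⟨(1, 1), by decide⟩
      - p ⟨(2, 2), by decide⟩ - p ⟨(1, 2), by decide⟩ + p ⟨(2, 1), by decide⟩,
    -p ⟨(1, 0), by decide⟩ - p ⟨(2, 0), by decide⟩ - p ⟨(1, 1), by decide⟩
      - p ⟨(2, 2), by decide⟩ - p ⟨(1, 2), by decide⟩ - p ⟨(2, 1), by decide⟩,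
    p ⟨(1, 1), by decide⟩ + p ⟨(2, 2), by decide⟩ - p ⟨(1, 2), by decide⟩
      - p ⟨(2, 1), by decide⟩,
    -p ⟨(0, 1), by decide⟩ - p ⟨(0, 2), by decide⟩ - p ⟨(1, 1), by decide⟩
      - p ⟨(2, 2), by decide⟩ - p ⟨(1, 2), by decide⟩ - p ⟨(2, 1), by decide⟩,
    -p ⟨(0, 1), by decide⟩ + p ⟨(0, 2), by decide⟩ + p ⟨(1, 1), by decide⟩
      - p ⟨(2, 2), by decide⟩ - p ⟨(1, 2), by decide⟩ + p ⟨(2, 1), by decide⟩,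
    -p ⟨(1, 0), by decide⟩ + p ⟨(2, 0), by decide⟩ + p ⟨(1, 1), by decide⟩
      - p ⟨(2, 2), by decide⟩ + p ⟨(1, 2), by decide⟩ - p ⟨(2, 1), by decide⟩,
    -p ⟨(1, 0), by decide⟩ - p ⟨(2, 0), by decide⟩ - p ⟨(0, 1), by decide⟩
      - p ⟨(0, 2), by decide⟩ - p ⟨(1, 1), by decide⟩ - p ⟨(2, 2), by decide⟩
      - p ⟨(1, 2), by decide⟩ - p ⟨(2, 1), by decide⟩]
  map_add' p q := by ext i; fin_cases i <;> simp <;> ring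
  map_smul' r p := by ext i; fin_cases i <;> simp <;> ring

theorem coords_injective [CharP F 3] : Function.Injective (coords : (OkI → F) →ₗ[F] _) := by
  rw [injective_iff_map_eq_zero]
  intro p hp
  have h (i) := congrFun hp i
  have h0 := h 0
  have h1 := h 1
  have h2 := h 2
  have h3 := h 3
  have h4 := h 4
  have h5 := h 5
  have h6 := h 6
  have h7 := h 7
  simp [coords] at h0 h1 h2 h3 h4 h5 h6 h7
  ext g
  have hg : ∀ g : OkI, g = ⟨(1, 0), by decide⟩ ∨ g = ⟨(2, 0), by decide⟩ ∨
      g = ⟨(0, 1), by decide⟩ ∨ g = ⟨(0, 2), by decide⟩ ∨ g = ⟨(1, 1), by decide⟩ ∨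
      g = ⟨(2, 2), by decide⟩ ∨ g = ⟨(1, 2), by decide⟩ ∨ g = ⟨(2, 1), by decide⟩ := by decide
  rcases hg g with rfl | rfl | rfl | rfl | rfl | rfl | rfl | rfl <;> simp <;> grind

set_option maxHeartbeats 2000000 in
theorem coords_okMul [CharP F 3] (p q : OkI → F) :
    coords (okMul F p q) = mul (coords p) (coords q) := by
  change coords (okMulFun F p q) = _
  simp only [coords, mul, okMulFun_one_zero, okMulFun_two_zero, okMulFun_zero_one,
    okMulFun_zero_two, okMulFun_one_one, okMulFun_two_two, okMulFun_one_two,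
    okMulFun_two_one, LinearMap.coe_mk, AddHom.coe_mk]
  generalize p ⟨(1, 0), _⟩ = p0
  generalize p ⟨(2, 0), _⟩ = p1
  generalize p ⟨(0, 1), _⟩ = p2
  generalize p ⟨(0, 2), _⟩ = p3
  generalize p ⟨(1, 1), _⟩ = p4
  generalize p ⟨(2, 2), _⟩ = p5
  generalize p ⟨(1, 2), _⟩ = p6
  generalize p ⟨(2, 1), _⟩ = p7
  generalize q ⟨(1, 0), _⟩ = q0
  generalize q ⟨(2, 0), _⟩ = q1
  generalize q ⟨(0, 1), _⟩ = q2
  generalize q ⟨(0, 2), _⟩ = q3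
  generalize q ⟨(1, 1), _⟩ = q4
  generalize q ⟨(2, 2), _⟩ = q5
  generalize q ⟨(1, 2), _⟩ = q6
  generalize q ⟨(2, 1), _⟩ = q7
  ext i
  fin_cases i <;> simp <;> grind

theorem norm_coords [CharP F 3] (p : OkI → F) : norm (coords p) = okN F p := by
  simp [coords, norm, okN]
  grind

/-- The coordinates of the split Okubo algebra, as a linear equivalence. -/
noncomputable def coordsEquiv [CharP F 3] : (OkI → F) ≃ₗ[F] (Fin 8 → F) :=
  LinearEquiv.ofInjectiveOfFinrankEq coords coords_injective (by simp)

theorem coordsEquiv_okMul [CharP F 3] (p q : OkI → F) :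
    coordsEquiv (okMul F p q) = mul (coordsEquiv p) (coordsEquiv q) :=
  coords_okMul p q

theorem norm_coordsEquiv [CharP F 3] (p : OkI → F) : norm (coordsEquiv p) = okN F p :=
  norm_coords p

theorem coordsEquiv_symm_mul [CharP F 3] (x y : Fin 8 → F) :
    coordsEquiv.symm (mul x y) = okMul F (coordsEquiv.symm x) (coordsEquiv.symm y) := by
  rw [LinearEquiv.symm_apply_eq, coordsEquiv_okMul, LinearEquiv.apply_symm_apply,
    LinearEquiv.apply_symm_apply]

theorem okN_coordsEquiv_symm [CharP F 3] (x : Fin 8 → F) :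
    okN F (coordsEquiv.symm x) = norm x := by
  rw [← norm_coordsEquiv, LinearEquiv.apply_symm_apply]

/-- Two elements of the split Okubo algebra are conjugate if some automorphism preserving the
norm maps the first to the second. -/
def Conj (f g : OkI → F) : Prop :=
  ∃ φ : (OkI → F) ≃ₗ[F] (OkI → F), (∀ x y, φ (okMul F x y) = okMul F (φ x) (φ y)) ∧
    (∀ x, okN F (φ x) = okN F x) ∧ φ f = g

theorem Conj.refl (f : OkI → F) : Conj f f :=
  ⟨LinearEquiv.refl F _, fun _ _ => rfl, fun _ => rfl, rfl⟩

theorem Conj.symm {f g : OkI → F} : Conj f g → Conj g f := by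
  rintro ⟨φ, hmul, hnorm, rfl⟩
  refine ⟨φ.symm, fun x y => ?_, fun x => ?_, φ.symm_apply_apply f⟩
  · rw [LinearEquiv.symm_apply_eq, hmul, LinearEquiv.apply_symm_apply,
      LinearEquiv.apply_symm_apply]
  · rw [← hnorm, LinearEquiv.apply_symm_apply]

theorem Conj.trans {f g h : OkI → F} : Conj f g → Conj g h → Conj f h := by
  rintro ⟨φ, hmul, hnorm, rfl⟩ ⟨ψ, hmul', hnorm', rfl⟩
  exact ⟨φ.trans ψ, fun x y => by simp [hmul, hmul'], fun x => by simp [hnorm, hnorm'], rfl⟩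

/-- Conjugate elements have centralizers on which the norm has radicals of the same dimension. -/
theorem Conj.finrank_okRad {f g : OkI → F} :
    Conj f g → Module.finrank F (okRad F f) = Module.finrank F (okRad F g) := by
  rintro ⟨φ, hmul, hnorm, rfl⟩
  have hcent (x : OkI → F) : φ x ∈ okCent F (φ f) ↔ x ∈ okCent F f := by
    change okMul F (φ x) (φ f) = okMul F (φ f) (φ x) ↔ okMul F x f = okMul F f x
    rw [← hmul, ← hmul, φ.injective.eq_iff]
  have hrad (x : OkI → F) : φ x ∈ okRad F (φ f) ↔ x ∈ okRad F f := by
    change φ x ∈ okCent F (φ f) ∧ okN F (φ x) = 0 ∧ (∀ w ∈ okCent F (φ f), okB F (φ x) w = 0) ↔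
      x ∈ okCent F f ∧ okN F x = 0 ∧ ∀ w ∈ okCent F f, okB F x w = 0
    rw [hcent, hnorm, φ.surjective.forall]
    simp only [hcent, okB, ← map_add, hnorm]
  have : okRad F (φ f) = (okRad F f).map (φ : (OkI → F) →ₗ[F] (OkI → F)) := by
    ext y
    obtain ⟨x, rfl⟩ := φ.surjective y
    simp [hrad]
  rw [this, LinearEquiv.finrank_map_eq]

theorem mem_okCent_coordsEquiv_symm [CharP F 3] (a x : Fin 8 → F) :
    coordsEquiv.symm x ∈ okCent F (coordsEquiv.symm a) ↔ mul x a = mul a x := by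
  change okMul F _ _ = okMul F _ _ ↔ _
  rw [← coordsEquiv_symm_mul, ← coordsEquiv_symm_mul, coordsEquiv.symm.injective.eq_iff]

theorem mem_okRad_coordsEquiv_symm [CharP F 3] (a x : Fin 8 → F) :
    coordsEquiv.symm x ∈ okRad F (coordsEquiv.symm a) ↔ mul x a = mul a x ∧ norm x = 0 ∧
      ∀ y, mul y a = mul a y → norm (x + y) - norm x - norm y = 0 := by
  change coordsEquiv.symm x ∈ okCent F _ ∧ okN F _ = 0 ∧ (∀ w ∈ okCent F _, okB F _ w = 0) ↔ _
  simp [mem_okCent_coordsEquiv_symm, okN_coordsEquiv_symm, coordsEquiv.symm.surjective.forall, okB, ← map_add]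

theorem conj_of_leftInverse [CharP F 3] (ψ ψ' : (Fin 8 → F) →ₗ[F] (Fin 8 → F))
    (h : ∀ x, ψ (ψ' x) = x) (hmul : ∀ x y, ψ (mul x y) = mul (ψ x) (ψ y))
    (hnorm : ∀ x, norm (ψ x) = norm x) (x : Fin 8 → F) :
    Conj (coordsEquiv.symm x) (coordsEquiv.symm (ψ x)) := by
  have hinj : Function.Injective ψ := LinearMap.injective_iff_surjective.mpr fun y => ⟨ψ' y, h y⟩
  refine ⟨coordsEquiv.trans ((LinearEquiv.ofInjectiveEndo ψ hinj).trans coordsEquiv.symm),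
    fun p q => ?_, fun p => ?_, ?_⟩
  · simp [coordsEquiv_okMul, hmul, coordsEquiv_symm_mul]
  · simp [okN_coordsEquiv_symm, hnorm, norm_coordsEquiv]
  · simp

theorem conj_shear [CharP F 3] (a b : F) (x : Fin 8 → F) :
    Conj (coordsEquiv.symm x) (coordsEquiv.symm (shear a b x)) :=
  conj_of_leftInverse _ (shear (-a) (-b)) (shear_shear_neg a b) (shear_mul a b) (norm_shear a b) x

theorem conj_moebius [CharP F 3] (c : F) (x : Fin 8 → F) :
    Conj (coordsEquiv.symm x) (coordsEquiv.symm (moebius c x)) :=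
  conj_of_leftInverse _ (moebius (-c)) (moebius_moebius_neg c) (moebius_mul c) (norm_moebius c) x

theorem conj_swap [CharP F 3] (x : Fin 8 → F) :
    Conj (coordsEquiv.symm x) (coordsEquiv.symm (swap x)) :=
  conj_of_leftInverse _ (swap ∘ₗ swap ∘ₗ swap) swap_four swap_mul norm_swap x

/-- Transvections and a quarter turn act transitively on the nonzero vectors of the plane. -/
theorem forall_ne_zero_of_transvection {P : F → F → Prop} (h10 : P 1 0)
    (htrans : ∀ a s t, P s (t + a * s) → P s t) (hturn : ∀ s t, P t (-s) → P s t)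
    {s t : F} (h : s ≠ 0 ∨ t ≠ 0) : P s t := by
  have hone (t : F) : P 1 t := htrans (-t) 1 t (by simpa using h10)
  have hne {s t : F} (hs : s ≠ 0) : P s t :=
    htrans ((1 - t) / s) s t (by simpa [hs] using hturn s 1 (hone _))
  by_cases hs : s = 0
  · exact hturn s t (hne (h.resolve_left (not_not_intro hs)))
  · exact hne hs

/-- The coordinates of the quadratic idempotent `u² + u²v² - 1`. -/
def quadIdem : Fin 8 → F := ![0, 0, 1, 0, 0, 0, 0, 1]

/-- The coordinates of the singular idempotent `u²v + u²v² - 1`. -/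
def singIdem : Fin 8 → F := ![0, 0, 0, 0, 0, 1, 0, 1]

theorem conj_quadIdem [CharP F 3] {s t : F} (h : s ≠ 0 ∨ t ≠ 0) (p q : F) :
    Conj (coordsEquiv.symm ![0, 0, s * s, -(s * t), t * t, p, q, 1])
      (coordsEquiv.symm quadIdem) := by
  revert p q
  refine forall_ne_zero_of_transvection
    (P := fun s t => ∀ p q, Conj (coordsEquiv.symm ![0, 0, s * s, -(s * t), t * t, p, q, 1])
      (coordsEquiv.symm quadIdem)) (fun p q => ?_) (fun a s t ih p q => ?_)
    (fun s t ih p q => ?_) h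
  · refine (conj_moebius p _).trans ((conj_shear 0 q _).trans ?_)
    convert Conj.refl _ using 2
    ext i
    fin_cases i <;> simp [shear, moebius, quadIdem]
  · refine (conj_shear a 0 _).trans ?_
    convert ih p (q - a * p) using 2
    ext i
    fin_cases i <;> simp [shear] <;> grind
  · refine (conj_swap _).trans ?_
    convert ih q (-p) using 2
    ext i
    fin_cases i <;> simp [swap, mul_comm]

theorem conj_singIdem [CharP F 3] {s t : F} (h : s ≠ 0 ∨ t ≠ 0) :
    Conj (coordsEquiv.symm ![0, 0, 0, 0, 0, s, t, 1]) (coordsEquiv.symm singIdem) := by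
  refine forall_ne_zero_of_transvection
    (P := fun s t => Conj (coordsEquiv.symm ![0, 0, 0, 0, 0, s, t, 1])
      (coordsEquiv.symm singIdem)) ?_ (fun a s t ih => ?_) (fun s t ih => ?_) h
  · exact Conj.refl _
  · refine (conj_shear (-a) 0 _).trans ?_
    convert ih using 2
    ext i
    fin_cases i <;> simp [shear]
  · refine (conj_swap _).trans ?_
    convert ih using 2
    ext i
    fin_cases i <;> simp [swap]

theorem finrank_okRad_quadIdem_le [CharP F 3] :
    Module.finrank F (okRad F (coordsEquiv.symm (quadIdem : Fin 8 → F))) ≤ 2 := by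
  let L : okRad F (coordsEquiv.symm (quadIdem : Fin 8 → F)) →ₗ[F] (Fin 2 → F) :=
    LinearMap.pi ![LinearMap.proj 2 ∘ₗ coordsEquiv.toLinearMap ∘ₗ Submodule.subtype _,
      LinearMap.proj 5 ∘ₗ coordsEquiv.toLinearMap ∘ₗ Submodule.subtype _]
  have hL : Function.Injective L := by
    rw [injective_iff_map_eq_zero]
    rintro ⟨v, hv⟩ h0
    obtain ⟨x, rfl⟩ := coordsEquiv.symm.surjective v
    have hx2 := congrFun h0 0
    have hx5 := congrFun h0 1
    obtain ⟨hx, -, hb⟩ := (mem_okRad_coordsEquiv_symm _ _).mp hv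
    have hb1 := hb ![0, 0, 0, 0, 0, 0, 0, 1]
      (by ext i; fin_cases i <;> simp [mul, quadIdem])
    have hb2 := hb ![1, 0, 0, 0, 0, 0, -1, 0]
      (by ext i; fin_cases i <;> simp [mul, quadIdem])
    have hx' (i) := congrFun hx i
    have e0 := hx' 0
    have e1 := hx' 1
    have e2 := hx' 2
    have e3 := hx' 3
    have e4 := hx' 4
    have e5 := hx' 5
    have e6 := hx' 6
    simp [mul, quadIdem] at e0 e1 e2 e3 e4 e5 e6
    simp [norm] at hb1 hb2
    simp [L] at hx2 hx5
    have : x = 0 := by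
      ext i
      fin_cases i <;> simp <;> grind
    simp [this]
  simpa using LinearMap.finrank_le_finrank_of_injective hL

theorem three_le_finrank_okRad_singIdem [CharP F 3] :
    3 ≤ Module.finrank F (okRad F (coordsEquiv.symm (singIdem : Fin 8 → F))) := by
  let L : (Fin 3 → F) →ₗ[F] (Fin 8 → F) :=
    { toFun := fun c => ![0, 0, c 0, 0, 0, c 1, c 2, 0]
      map_add' := fun c d => by ext i; fin_cases i <;> simp
      map_smul' := fun r c => by ext i; fin_cases i <;> simp }
  have hL (c) : (coordsEquiv.symm.toLinearMap ∘ₗ L) c ∈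
      okRad F (coordsEquiv.symm (singIdem : Fin 8 → F)) := by
    refine (mem_okRad_coordsEquiv_symm _ _).mpr ⟨?_, ?_, fun y hy => ?_⟩
    · ext i
      fin_cases i <;> simp [L, mul, singIdem]
    · simp [L, norm]
    · have hy' (i) := congrFun hy i
      have e2 := hy' 2
      have e3 := hy' 3
      have e5 := hy' 5
      have e6 := hy' 6
      simp [mul, singIdem] at e2 e3 e5 e6
      simp [L, norm]
      grind
  have hinj : Function.Injective ((coordsEquiv.symm.toLinearMap ∘ₗ L).codRestrict _ hL) := by
    rw [injective_iff_map_eq_zero]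
    intro c hc
    have hc' : L c = 0 := by simpa using congrArg Subtype.val hc
    have h2 := congrFun hc' 2
    have h5 := congrFun hc' 5
    have h6 := congrFun hc' 6
    ext i
    fin_cases i <;> assumption
  simpa using LinearMap.finrank_le_finrank_of_injective hinj

/-- The centralizer of the quaternionic idempotent `u²v² - 1` has dimension at least six. -/
theorem six_le_finrank_okCent_quaternionic [CharP F 3] :
    6 ≤ Module.finrank F (okCent F (coordsEquiv.symm (![0, 0, 0, 0, 0, 0, 0, 1] : Fin 8 → F))) := by
  let L : (Fin 6 → F) →ₗ[F] (Fin 8 → F) :=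
    { toFun := fun c => ![0, 0, c 0, c 1, c 2, c 3, c 4, c 5]
      map_add' := fun c d => by ext i; fin_cases i <;> simp
      map_smul' := fun r c => by ext i; fin_cases i <;> simp }
  have hL (c) : (coordsEquiv.symm.toLinearMap ∘ₗ L) c ∈
      okCent F (coordsEquiv.symm (![0, 0, 0, 0, 0, 0, 0, 1] : Fin 8 → F)) := by
    rw [LinearMap.comp_apply, LinearEquiv.coe_coe, mem_okCent_coordsEquiv_symm]
    ext i
    fin_cases i <;> simp [L, mul]
  have hinj : Function.Injective ((coordsEquiv.symm.toLinearMap ∘ₗ L).codRestrict _ hL) := by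
    rw [injective_iff_map_eq_zero]
    intro c hc
    have hc' : L c = 0 := by simpa using congrArg Subtype.val hc
    ext i
    fin_cases i
    · exact congrFun hc' 2
    · exact congrFun hc' 3
    · exact congrFun hc' 4
    · exact congrFun hc' 5
    · exact congrFun hc' 6
    · exact congrFun hc' 7
  simpa using LinearMap.finrank_le_finrank_of_injective hinj

/-- An idempotent whose centralizer has dimension four is conjugate to the standard quadratic or
the standard singular idempotent. -/
theorem conj_quadIdem_or_singIdem [CharP F 3] [IsAlgClosed F] {f : OkI → F}
    (hf : okMul F f f = f) (hf0 : f ≠ 0) (hf4 : Module.finrank F (okCent F f) = 4) :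
    Conj f (coordsEquiv.symm quadIdem) ∨ Conj f (coordsEquiv.symm singIdem) := by
  obtain ⟨x, rfl⟩ := coordsEquiv.symm.surjective f
  rw [← coordsEquiv_symm_mul, coordsEquiv.symm.injective.eq_iff] at hf
  obtain ⟨h0, h1, h7, h34⟩ := coords_of_idempotent hf (by rintro rfl; simp at hf0)
  obtain ⟨s, t, h2, h3, h4⟩ : ∃ s t, x 2 = s * s ∧ x 3 = -(s * t) ∧ x 4 = t * t := by
    obtain ⟨s, hs⟩ := IsAlgClosed.exists_eq_mul_self (x 2)
    obtain ⟨t, ht⟩ := IsAlgClosed.exists_eq_mul_self (x 4)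
    have hst : (x 3 + s * t) * (x 3 - s * t) = 0 := by
      rw [hs, ht] at h34
      linear_combination h34
    rcases mul_eq_zero.mp hst with h | h
    · exact ⟨s, t, hs, by linear_combination h, ht⟩
    · exact ⟨s, -t, hs, by linear_combination h, by simpa using ht⟩
  have hx : x = ![0, 0, s * s, -(s * t), t * t, x 5, x 6, 1] := by
    ext i
    fin_cases i <;> simp [h0, h1, h2, h3, h4, h7]
  rw [hx] at hf4 ⊢
  by_cases hst : s ≠ 0 ∨ t ≠ 0
  · exact Or.inl (conj_quadIdem hst _ _)
  obtain ⟨rfl, rfl⟩ : s = 0 ∧ t = 0 := by simpa using hst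
  by_cases h56 : x 5 ≠ 0 ∨ x 6 ≠ 0
  · exact Or.inr (by simpa using conj_singIdem h56)
  obtain ⟨h5, h6⟩ : x 5 = 0 ∧ x 6 = 0 := by simpa using h56
  have := six_le_finrank_okCent_quaternionic (F := F)
  rw [h5, h6] at hf4
  rw [mul_zero, neg_zero] at hf4
  omega

end OkModel

/-- Over an algebraically closed field of characteristic `3`, any two
quadratic idempotents (centralizer of dimension `4`, norm of rank `2` on it) of the split
Okubo algebra are conjugate under an automorphism, and likewise any two singular
idempotents (centralizer of dimension `4`, norm of rank `1` on it). -/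
theorem okubo_quadratic_singular_idempotent_orbits (F : Type) [Field F] [IsAlgClosed F]
    [CharP F 3] (f g : OkI → F)
    (hf : okMul F f f = f) (hf0 : f ≠ 0) (hg : okMul F g g = g) (hg0 : g ≠ 0)
    (hf4 : Module.finrank F (okCent F f) = 4)
    (hg4 : Module.finrank F (okCent F g) = 4)
    (hrank :
      (Module.finrank F (okCent F f) - Module.finrank F (okRad F f) = 2 ∧
        Module.finrank F (okCent F g) - Module.finrank F (okRad F g) = 2) ∨
      (Module.finrank F (okCent F f) - Module.finrank F (okRad F f) = 1 ∧
        Module.finrank F (okCent F g) - Module.finrank F (okRad F g) = 1)) :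
    ∃ φ : (OkI → F) ≃ₗ[F] (OkI → F),
      (∀ x y, φ (okMul F x y) = okMul F (φ x) (φ y)) ∧ φ f = g := by
  have hconj {p q : OkI → F} (h : OkModel.Conj p q) :
      ∃ φ : (OkI → F) ≃ₗ[F] (OkI → F),
        (∀ x y, φ (okMul F x y) = okMul F (φ x) (φ y)) ∧ φ p = q :=
    h.imp fun _ hφ => ⟨hφ.1, hφ.2.2⟩
  have hquad := OkModel.finrank_okRad_quadIdem_le (F := F)
  have hsing := OkModel.three_le_finrank_okRad_singIdem (F := F)
  rcases OkModel.conj_quadIdem_or_singIdem hf hf0 hf4 with cf | cf <;>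
  rcases OkModel.conj_quadIdem_or_singIdem hg hg0 hg4 with cg | cg
  · exact hconj (cf.trans cg.symm)
  · have := cf.finrank_okRad
    have := cg.finrank_okRad
    omega
  · have := cf.finrank_okRad
    have := cg.finrank_okRad
    omega
  · exact hconj (cf.trans cg.symm)
end
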